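/- If q mod n ∈ D₀, then Λ(β)^q = Λ(β), so Λ(β) lies in the subfield GF(q) of GF(q^m). If q mod n ∈ D₁, then Λ(β)^q = −(Λ(β)+1). -/

import Mathlib

/-- The product of the quadratic characters modulo `a` and `b`, as a character of `ZMod (a * b)`. -/
def quadraticCharMul (a b : ℕ) [Fact a.Prime] [Fact b.Prime] : ZMod (a * b) →* ℤ :=
  (quadraticChar (ZMod a)).toMonoidHom.comp
      (ZMod.castHom (Dvd.intro b rfl) (ZMod a)).toMonoidHom *
    (quadraticChar (ZMod b)).toMonoidHom.comp
      (ZMod.castHom (Dvd.intro_left a rfl) (ZMod b)).toMonoidHom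

lemma quadraticCharMul_apply (a b : ℕ) [Fact a.Prime] [Fact b.Prime] (x : ZMod (a * b)) :
    quadraticCharMul a b x =
      quadraticChar (ZMod a) (ZMod.castHom (Dvd.intro b rfl) (ZMod a) x) *
        quadraticChar (ZMod b) (ZMod.castHom (Dvd.intro_left a rfl) (ZMod b) x) := rfl

lemma quadraticCharMul_natCast (a b : ℕ) [Fact a.Prime] [Fact b.Prime] (k : ℕ) :
    quadraticCharMul a b k = quadraticChar (ZMod a) k * quadraticChar (ZMod b) k := by
  simp [quadraticCharMul_apply]

lemma quadraticCharMul_eq_zero_iff (a b : ℕ) [Fact a.Prime] [Fact b.Prime] (x : ZMod (a * b)) :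
    quadraticCharMul a b x = 0 ↔
      ZMod.castHom (Dvd.intro b rfl) (ZMod a) x = 0 ∨
        ZMod.castHom (Dvd.intro_left a rfl) (ZMod b) x = 0 := by
  rw [quadraticCharMul_apply, mul_eq_zero, quadraticChar_eq_zero_iff, quadraticChar_eq_zero_iff]

lemma quadraticCharMul_trichotomy (a b : ℕ) [Fact a.Prime] [Fact b.Prime] (x : ZMod (a * b)) :
    quadraticCharMul a b x = 0 ∨ quadraticCharMul a b x = 1 ∨ quadraticCharMul a b x = -1 := by
  rw [or_iff_not_imp_left, quadraticCharMul_eq_zero_iff, not_or, quadraticCharMul_apply]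
  rintro ⟨h₁, h₂⟩
  rcases quadraticChar_dichotomy h₁ with h | h <;>
    rcases quadraticChar_dichotomy h₂ with h' | h' <;> rw [h, h'] <;> norm_num

lemma ZMod.castHom_eq_iff {a b : ℕ} (h : a.Coprime b) (x y : ZMod (a * b)) :
    x = y ↔
      ZMod.castHom (Dvd.intro b rfl) (ZMod a) x = ZMod.castHom (Dvd.intro b rfl) (ZMod a) y ∧
        ZMod.castHom (Dvd.intro_left a rfl) (ZMod b) x =
          ZMod.castHom (Dvd.intro_left a rfl) (ZMod b) y := by
  refine ⟨fun hxy ↦ by simp [hxy], fun hxy ↦ (ZMod.chineseRemainder h).injective ?_⟩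
  have aux (z : ZMod (a * b)) : ZMod.chineseRemainder h z =
      (ZMod.castHom (Dvd.intro b rfl) (ZMod a) z, ZMod.castHom (Dvd.intro_left a rfl) (ZMod b) z) :=
    congrArg (fun f : ZMod (a * b) →+* ZMod a × ZMod b ↦ f z) (Subsingleton.elim
      (ZMod.chineseRemainder h).toRingHom
      ((ZMod.castHom (Dvd.intro b rfl) (ZMod a)).prod
        (ZMod.castHom (Dvd.intro_left a rfl) (ZMod b))))
  rw [aux, aux, hxy.1, hxy.2]

lemma ZMod.exists_pow_eq_of_orderOf_eq {p : ℕ} [Fact p.Prime] {x y : ZMod p}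
    (hx : orderOf x = p - 1) (hy : y ≠ 0) : ∃ k, x ^ k = y := by
  have : NeZero (p - 1) := ⟨(Nat.sub_pos_of_lt (Fact.out : p.Prime).one_lt).ne'⟩
  obtain ⟨k, -, hk⟩ := (hx ▸ IsPrimitiveRoot.orderOf x).eq_pow_of_pow_eq_one
    (ZMod.pow_card_sub_one_eq_one hy)
  exact ⟨k, hk⟩

lemma quadraticChar_eq_neg_one_of_orderOf_eq {p : ℕ} [Fact p.Prime] (hp : Odd p) {x : ZMod p}
    (hx : orderOf x = p - 1) : quadraticChar (ZMod p) x = -1 := by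
  have hp2 := (Fact.out : p.Prime).two_le
  have hx0 : x ≠ 0 := by
    rintro rfl
    have h := pow_orderOf_eq_one (0 : ZMod p)
    rw [hx, zero_pow (by omega)] at h
    exact zero_ne_one h
  rw [quadraticChar_neg_one_iff_not_isSquare, ZMod.euler_criterion p hx0]
  intro h
  have := Nat.le_of_dvd (by omega) (orderOf_dvd_of_pow_eq_one h)
  obtain ⟨k, rfl⟩ := hp
  omega

lemma AddChar.sum_eq_zero_of_add_mem {G R : Type*} [AddCommGroup G] [CommRing R]
    [IsDomain R] (φ : AddChar G R) (T : Finset G) (t : G) (hT : ∀ x, x + t ∈ T ↔ x ∈ T)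
    (ht : φ t ≠ 1) : ∑ x ∈ T, φ x = 0 := by
  have h : φ t * ∑ x ∈ T, φ x = ∑ x ∈ T, φ x := by
    rw [Finset.mul_sum]
    refine Finset.sum_equiv (Equiv.addRight t) (fun x ↦ (hT x).symm) fun x _ ↦ ?_
    rw [Equiv.coe_addRight, AddChar.map_add_eq_mul, mul_comm]
  by_contra h0
  exact ht (mul_right_cancel₀ h0 (h.trans (one_mul _).symm))

section CharacterSums

variable {a b : ℕ} [Fact a.Prime] [Fact b.Prime] {R : Type*} [CommRing R]

lemma AddChar.sum_castHom_left_eq_zero [IsDomain R] {φ : AddChar (ZMod (a * b)) R}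
    (hφ : φ (a : ZMod (a * b)) ≠ 1) :
    ∑ x : ZMod (a * b) with ZMod.castHom (Dvd.intro b rfl) (ZMod a) x = 0, φ x = 0 :=
  φ.sum_eq_zero_of_add_mem _ (a : ZMod (a * b)) (by simp [-ZMod.castHom_apply]) hφ

lemma AddChar.sum_castHom_right_eq_zero [IsDomain R] {φ : AddChar (ZMod (a * b)) R}
    (hφ : φ (b : ZMod (a * b)) ≠ 1) :
    ∑ x : ZMod (a * b) with ZMod.castHom (Dvd.intro_left a rfl) (ZMod b) x = 0, φ x = 0 :=
  φ.sum_eq_zero_of_add_mem _ (b : ZMod (a * b)) (by simp [-ZMod.castHom_apply]) hφ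

lemma AddChar.sum_quadraticCharMul_add [IsDomain R] (hab : a.Coprime b)
    {φ : AddChar (ZMod (a * b)) R}
    (ha : φ (a : ZMod (a * b)) ≠ 1) (hb : φ (b : ZMod (a * b)) ≠ 1) :
    ∑ x with quadraticCharMul a b x = 1, φ x + ∑ x with quadraticCharMul a b x = -1, φ x = 1 := by
  have htot : ∑ x, φ x = 0 := φ.sum_eq_zero_of_add_mem _ (a : ZMod (a * b)) (by simp) ha
  have hA := AddChar.sum_castHom_left_eq_zero ha
  have hB := AddChar.sum_castHom_right_eq_zero hb
  have h0 : ∑ x : ZMod (a * b) with x = 0, φ x = 1 := by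
    simp [Finset.filter_eq']
  have key : ∑ x with quadraticCharMul a b x = 1, φ x + ∑ x with quadraticCharMul a b x = -1, φ x
      + ∑ x : ZMod (a * b) with ZMod.castHom (Dvd.intro b rfl) (ZMod a) x = 0, φ x
      + ∑ x : ZMod (a * b) with ZMod.castHom (Dvd.intro_left a rfl) (ZMod b) x = 0, φ x
      = ∑ x, φ x + ∑ x : ZMod (a * b) with x = 0, φ x := by
    simp only [Finset.sum_filter, ← Finset.sum_add_distrib]
    refine Finset.sum_congr rfl fun x _ ↦ ?_
    have hz := quadraticCharMul_eq_zero_iff a b x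
    have hx := ZMod.castHom_eq_iff hab x 0
    rw [map_zero, map_zero] at hx
    rcases quadraticCharMul_trichotomy a b x with h | h | h
    · rw [h] at hz ⊢
      replace hz := hz.1 rfl
      rcases hz with hz | hz <;> simp [-ZMod.castHom_apply, hx, hz, add_comm]
    · rw [h] at hz ⊢
      simp only [one_ne_zero, false_iff, not_or] at hz
      simp [-ZMod.castHom_apply, hx, hz]
    · rw [h] at hz ⊢
      simp only [neg_eq_zero, one_ne_zero, false_iff, not_or] at hz
      simp [-ZMod.castHom_apply, hx, hz]
  linear_combination key + htot + h0 - hA - hB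

lemma AddChar.sum_quadraticCharMul_pow (φ : AddChar (ZMod (a * b)) R) {p k : ℕ} [Fact p.Prime]
    [CharP R p] (hco : (a * b).Coprime (p ^ k)) {c : ℤ}
    (hq : IsUnit (quadraticCharMul a b (p ^ k : ℕ))) :
    (∑ x with quadraticCharMul a b x = c, φ x) ^ p ^ k =
      ∑ x with quadraticCharMul a b x = quadraticCharMul a b (p ^ k : ℕ) * c, φ x := by
  rw [← iterateFrobenius_def, map_sum]
  refine Finset.sum_equiv (Units.mulLeft (ZMod.unitOfCoprime (p ^ k) hco.symm)) (fun x ↦ ?_)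
    fun x _ ↦ ?_
  · simp only [Finset.mem_filter, Finset.mem_univ, true_and, Units.mulLeft_apply,
      ZMod.coe_unitOfCoprime, map_mul]
    exact hq.mul_right_inj.symm
  · change _ = φ ((p ^ k : ℕ) * x)
    rw [iterateFrobenius_def, ← nsmul_eq_mul, AddChar.map_nsmul_eq_pow]

end CharacterSums

/-- The Whiteman classes exhaust the elements that are nonzero modulo both primes. -/
lemma exists_eq_pow_mul_pow {a b d g u : ℕ} [Fact a.Prime] [Fact b.Prime] (hab : a.Coprime b)
    (hd : Nat.gcd (a - 1) (b - 1) = d) (hga : orderOf (g : ZMod a) = a - 1)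
    (hgb : orderOf (g : ZMod b) = b - 1) (hua : (u : ZMod a) = g) (hub : (u : ZMod b) = 1)
    {x : ZMod (a * b)} (hx : quadraticCharMul a b x ≠ 0) :
    ∃ i < d, ∃ s < (a - 1) * (b - 1) / d, x = (g : ZMod (a * b)) ^ s * (u : ZMod (a * b)) ^ i := by
  have ha1 : a - 1 ≠ 0 := (Nat.sub_pos_of_lt (Fact.out : a.Prime).one_lt).ne'
  have hb1 : b - 1 ≠ 0 := (Nat.sub_pos_of_lt (Fact.out : b.Prime).one_lt).ne'
  rw [Ne, quadraticCharMul_eq_zero_iff, not_or] at hx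
  obtain ⟨k, hk⟩ := ZMod.exists_pow_eq_of_orderOf_eq hga hx.1
  obtain ⟨l, hl⟩ := ZMod.exists_pow_eq_of_orderOf_eq hgb hx.2
  have hd0 : 0 < d := hd ▸ Nat.gcd_pos_of_pos_left _ (Nat.pos_of_ne_zero ha1)
  have hda : d ∣ a - 1 := hd ▸ Nat.gcd_dvd_left _ _
  -- `i ≡ k - l` modulo `d`, and `j ≡ k - i` modulo `a - 1`
  set i := (k + (d - 1) * l) % d with hi
  set j := k + (a - 1 - 1) * i with hj
  have hji : j + i ≡ k [MOD a - 1] := by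
    have : j + i = k + (a - 1) * i := by
      obtain ⟨t, ht⟩ := Nat.exists_eq_succ_of_ne_zero ha1
      rw [hj, ht, Nat.succ_sub_one, Nat.succ_eq_add_one]; ring
    rw [this, Nat.ModEq, Nat.add_mul_mod_self_left]
  have hil : i + l ≡ k [MOD d] := by
    have h : i + l ≡ k + (d - 1) * l + l [MOD d] := (Nat.mod_modEq _ _).add_right _
    have : k + (d - 1) * l + l = k + d * l := by
      obtain ⟨t, rfl⟩ := Nat.exists_eq_succ_of_ne_zero hd0.ne'
      rw [Nat.succ_sub_one, Nat.succ_eq_add_one]; ring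
    rw [this] at h
    exact h.trans (by rw [Nat.ModEq, Nat.add_mul_mod_self_left])
  have hjl : j ≡ l [MOD (a - 1).gcd (b - 1)] := by
    rw [hd]
    refine Nat.ModEq.add_right_cancel' i ((hji.of_dvd hda).trans ?_)
    rw [add_comm l]
    exact hil.symm
  refine ⟨i, Nat.mod_lt _ hd0, Nat.chineseRemainder' hjl, ?_, ?_⟩
  · subst hd
    exact Nat.chineseRemainder'_lt_lcm hjl ha1 hb1
  · have hsa := (Nat.chineseRemainder' hjl).2.1
    have hsb := (Nat.chineseRemainder' hjl).2.2
    rw [ZMod.castHom_eq_iff hab]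
    simp only [map_mul, map_pow, map_natCast]
    rw [← hk, ← hl, hua, hub, one_pow, mul_one, ← pow_add]
    exact ⟨pow_eq_pow_of_modEq ((hsa.add_right i).trans hji).symm (hga ▸ pow_orderOf_eq_one _),
      pow_eq_pow_of_modEq hsb.symm (hgb ▸ pow_orderOf_eq_one _)⟩

lemma ZMod.exists_natCast_mul_iff {a b : ℕ} [Fact a.Prime] [Fact b.Prime] (x : ZMod (a * b)) :
    (∃ k : ℕ, 1 ≤ k ∧ k ≤ b - 1 ∧ x = ((k * a : ℕ) : ZMod (a * b))) ↔
      ZMod.castHom (Dvd.intro b rfl) (ZMod a) x = 0 ∧ x ≠ 0 := by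
  have ha : 0 < a := (Fact.out : a.Prime).pos
  have hb : 0 < b := (Fact.out : b.Prime).pos
  constructor
  · rintro ⟨k, hk1, hkb, rfl⟩
    refine ⟨by simp, fun h ↦ ?_⟩
    rw [ZMod.natCast_eq_zero_iff, mul_comm a] at h
    have := Nat.le_of_dvd hk1 (Nat.dvd_of_mul_dvd_mul_right ha h)
    omega
  · rintro ⟨hx, hx0⟩
    rw [← ZMod.natCast_zmod_val x, map_natCast, ZMod.natCast_eq_zero_iff] at hx
    obtain ⟨k, hk⟩ := hx
    have hlt := ZMod.val_lt x
    rw [hk] at hlt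
    have hkb := lt_of_mul_lt_mul_left hlt ha.le
    have hk0 : k ≠ 0 := by
      rintro rfl
      exact hx0 ((ZMod.val_eq_zero x).1 (by simpa using hk))
    refine ⟨k, by omega, by omega, ?_⟩
    rw [mul_comm k, ← hk, ZMod.natCast_zmod_val]

theorem stmt_11
    (n₁ n₂ n e g u : ℕ)
    (hp₁ : n₁.Prime) (hp₂ : n₂.Prime)
    (hodd₁ : Odd n₁) (hodd₂ : Odd n₂) (hne : n₁ ≠ n₂)
    (h6 : Nat.gcd (n₁ - 1) (n₂ - 1) = 6)
    (hn : n = n₁ * n₂)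
    (he : e = (n₁ - 1) * (n₂ - 1) / 6)
    (hg₁ : orderOf (g : ZMod n₁) = n₁ - 1)
    (hg₂ : orderOf (g : ZMod n₂) = n₂ - 1)
    (hu₁ : (u : ZMod n₁) = (g : ZMod n₁))
    (hu₂ : (u : ZMod n₂) = 1)
    (W : ℕ → Finset (ZMod n))
    (hW : ∀ i, (W i : Set (ZMod n)) =
      {x | ∃ s < e, x = (g : ZMod n) ^ s * (u : ZMod n) ^ i})
    (P Q : Set (ZMod n))
    (hP : P = {x | ∃ k : ℕ, 1 ≤ k ∧ k ≤ n₂ - 1 ∧ x = ((k * n₁ : ℕ) : ZMod n)})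
    (hQ : Q = {x | ∃ k : ℕ, 1 ≤ k ∧ k ≤ n₁ - 1 ∧ x = ((k * n₂ : ℕ) : ZMod n)})
    (D₀ D₁ : Set (ZMod n))
    (hD₀ : D₀ = ↑(W 0) ∪ ↑(W 2) ∪ ↑(W 4)) (hD₁ : D₁ = ↑(W 1) ∪ ↑(W 3) ∪ ↑(W 5))
    (p a q m : ℕ) (hp : p.Prime) (ha : 0 < a) (hq : q = p ^ a)
    (hco : Nat.Coprime n q) (hm : m = orderOf (q : ZMod n))
    (F : Type) [Field F] [Fintype F] [CharP F p]
    (hF : Fintype.card F = q ^ m)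
    (β : F) (hβ : IsPrimitiveRoot β n)
    (C₁ : Finset (ZMod n))
    (hC₁ : (C₁ : Set (ZMod n)) = P ∪ ↑(W 1) ∪ ↑(W 3) ∪ ↑(W 5)) :
    (((q : ZMod n) ∈ D₀ →
        (∑ i ∈ C₁, β ^ i.val) ^ q = ∑ i ∈ C₁, β ^ i.val) ∧
    ((q : ZMod n) ∈ D₁ →
        (∑ i ∈ C₁, β ^ i.val) ^ q = -((∑ i ∈ C₁, β ^ i.val) + 1))) := by
  classical
  subst hn hq he
  have : Fact n₁.Prime := ⟨hp₁⟩
  have : Fact n₂.Prime := ⟨hp₂⟩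
  have : Fact p.Prime := ⟨hp⟩
  have hab : n₁.Coprime n₂ := (Nat.coprime_primes hp₁ hp₂).2 hne
  have hg : quadraticCharMul n₁ n₂ g = 1 := by
    rw [quadraticCharMul_natCast, quadraticChar_eq_neg_one_of_orderOf_eq hodd₁ hg₁,
      quadraticChar_eq_neg_one_of_orderOf_eq hodd₂ hg₂]
    norm_num
  have hu : quadraticCharMul n₁ n₂ u = -1 := by
    rw [quadraticCharMul_natCast, hu₁, hu₂, map_one,
      quadraticChar_eq_neg_one_of_orderOf_eq hodd₁ hg₁, mul_one]
  have hWχ (i : ℕ) (x) (hx : x ∈ (W i : Set (ZMod (n₁ * n₂)))) :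
      quadraticCharMul n₁ n₂ x = (-1) ^ i := by
    rw [hW] at hx
    obtain ⟨s, -, rfl⟩ := hx
    rw [map_mul, map_pow, map_pow, hg, hu, one_pow, one_mul]
  have hcover (x) (hx : quadraticCharMul n₁ n₂ x ≠ 0) :
      ∃ i < 6, x ∈ (W i : Set (ZMod (n₁ * n₂))) := by
    obtain ⟨i, hi, h⟩ := exists_eq_pow_mul_pow hab h6 hg₁ hg₂ hu₁ hu₂ hx
    exact ⟨i, hi, by rw [hW]; exact h⟩
  have hmem₀ (x) (hx : x ∈ D₀) : quadraticCharMul n₁ n₂ x = 1 := by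
    rw [hD₀] at hx
    rcases hx with (hx | hx) | hx <;> simpa using hWχ _ x hx
  have hmem₁ (x) : x ∈ D₁ ↔ quadraticCharMul n₁ n₂ x = -1 := by
    rw [hD₁]
    constructor
    · rintro ((hx | hx) | hx) <;> simpa [pow_succ] using hWχ _ x hx
    · intro hx
      obtain ⟨i, hi, hxi⟩ := hcover x (by rw [hx]; norm_num)
      have hχ := hWχ i x hxi
      rw [hx] at hχ
      interval_cases i <;> norm_num at hχ
      · exact .inl (.inl hxi)
      · exact .inl (.inr hxi)
      · exact .inr hxi
  set φ : AddChar (ZMod (n₁ * n₂)) F := AddChar.zmodChar (n₁ * n₂) hβ.pow_eq_one with hφ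
  have hφn₁ : φ (n₁ : ZMod (n₁ * n₂)) ≠ 1 := by
    rw [hφ, AddChar.zmodChar_apply']
    exact hβ.pow_ne_one_of_pos_of_lt hp₁.ne_zero (lt_mul_of_one_lt_right hp₁.pos hp₂.one_lt)
  have hφn₂ : φ (n₂ : ZMod (n₁ * n₂)) ≠ 1 := by
    rw [hφ, AddChar.zmodChar_apply']
    exact hβ.pow_ne_one_of_pos_of_lt hp₂.ne_zero (lt_mul_of_one_lt_left hp₂.pos hp₁.one_lt)
  have hΛ : ∑ i ∈ C₁, β ^ i.val = -1 + ∑ x with quadraticCharMul n₁ n₂ x = -1, φ x := by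
    have hC : C₁ = ({x | ZMod.castHom (Dvd.intro n₂ rfl) (ZMod n₁) x = 0} : Finset _).erase 0 ∪
        ({x | quadraticCharMul n₁ n₂ x = -1} : Finset _) := by
      rw [← Finset.coe_inj, hC₁, Set.union_assoc, Set.union_assoc,
        ← Set.union_assoc (W 1 : Set (ZMod (n₁ * n₂))), ← hD₁, hP]
      ext x
      simp only [Set.mem_union, hmem₁, Set.mem_ofPred_eq, ZMod.exists_natCast_mul_iff,
        Finset.mem_coe, Finset.mem_union, Finset.mem_erase, Finset.mem_filter, Finset.mem_univ,
        true_and]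
      tauto
    have hdisj : Disjoint
        (({x | ZMod.castHom (Dvd.intro n₂ rfl) (ZMod n₁) x = 0} : Finset _).erase 0)
        ({x | quadraticCharMul n₁ n₂ x = -1} : Finset _) := by
      refine Finset.disjoint_left.2 fun x hx hx' ↦ ?_
      have h0 := (quadraticCharMul_eq_zero_iff n₁ n₂ x).2
        (.inl (Finset.mem_filter.1 (Finset.mem_of_mem_erase hx)).2)
      rw [(Finset.mem_filter.1 hx').2] at h0
      norm_num at h0
    change ∑ i ∈ C₁, φ i = _
    rw [hC, Finset.sum_union hdisj, Finset.sum_erase_eq_sub (by simp [-ZMod.castHom_apply]),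
      AddChar.sum_castHom_left_eq_zero hφn₁, AddChar.map_zero_eq_one, zero_sub]
  have hsum := AddChar.sum_quadraticCharMul_add hab hφn₁ hφn₂
  have hpow (y : F) : (-1 + y) ^ p ^ a = -1 + y ^ p ^ a := by
    rw [← iterateFrobenius_def, map_add, map_neg, map_one, iterateFrobenius_def]
  rw [hΛ, hpow]
  constructor
  · intro h
    have h1 := hmem₀ _ h
    rw [AddChar.sum_quadraticCharMul_pow φ hco (by rw [h1]; norm_num), h1, one_mul]
  · intro h
    have h1 := (hmem₁ _).1 h
    rw [AddChar.sum_quadraticCharMul_pow φ hco (by rw [h1]; norm_num), h1, neg_one_mul, neg_neg]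
    linear_combination hsum
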